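/- For every vertex x ≠ 0 of the tree, the mean hitting time of the parent p(x) starting from x is E[T^x_{p(x)}] = π(B_x) / (μ_x·π(x)). -/

import Mathlib

open MeasureTheory ProbabilityTheory Filter Topology ENNReal

noncomputable section

/-- A discrete-time birth-and-death chain on a countable rooted tree `I`.
The tree is encoded by a root, a parent map and a depth function; the chain is
encoded by its transition matrix `P` (nonzero only between tree-neighbours and
on the diagonal) and by the laws `law x` of the trajectories started at `x`,
characterised by the cylinder formula.  `invm` is the reversible invariant
probability measure of the chain (positive recurrence). -/
structure TreeChain (I : Type*) [MeasurableSpace I] where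
  root : I
  par : I → I
  depth : I → ℕ
  par_root : par root = root
  depth_root : depth root = 0
  depth_eq_zero : ∀ x, depth x = 0 → x = root
  depth_par : ∀ x, x ≠ root → depth x = depth (par x) + 1
  P : I → I → ℝ≥0∞
  P_row : ∀ x, ∑' y, P x y = 1
  P_support : ∀ x y, P x y ≠ 0 → y = x ∨ y = par x ∨ x = par y
  lam_pos : ∀ x, x ≠ root → P (par x) x ≠ 0
  mu_pos : ∀ x, x ≠ root → P x (par x) ≠ 0
  law : I → Measure (ℕ → I)
  law_prob : ∀ x, IsProbabilityMeasure (law x)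
  law_start : ∀ x, law x {ω | ω 0 = x} = 1
  law_cyl : ∀ x (n : ℕ) (γ : ℕ → I), γ 0 = x →
    law x {ω | ∀ i ≤ n, ω i = γ i} = ∏ i ∈ Finset.range n, P (γ i) (γ (i + 1))
  invm : I → ℝ≥0∞
  invm_pos : ∀ x, invm x ≠ 0
  invm_sum : ∑' x, invm x = 1
  invm_rev : ∀ x y, invm x * P x y = invm y * P y x

/-- The hitting time of `y`, as an extended nonnegative real (`∞` if `y` is never hit). -/
def hitTime {I : Type*} (y : I) (ω : ℕ → I) : ℝ≥0∞ :=
  ⨅ (t : ℕ) (_ : ω t = y), (t : ℝ≥0∞)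

namespace TreeChain

variable {I : Type*} [MeasurableSpace I] (c : TreeChain I)

/-- The branch `B_x` stemming from `x`: the set of descendants of `x` (including `x`). -/
def branch (x : I) : Set I := {y | ∃ n, c.par^[n] y = x}

/-- The set `ℓ(x)` of vertices on the path from `x` to the root, the root excluded. -/
def pathToRoot (x : I) : Set I := {y | ∃ i < c.depth x, c.par^[i] x = y}

/-- The set `σ(x)` of children of `x`. -/
def children (x : I) : Set I := {y | y ≠ c.root ∧ c.par y = x}

/-- `μ_x`, the transition probability from `x` to its parent. -/
def mu (x : I) : ℝ≥0∞ := c.P x (c.par x)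

/-- `λ_x`, the transition probability from the parent of `x` to `x`. -/
def lamP (x : I) : ℝ≥0∞ := c.P (c.par x) x

/-- `π(A)`, the invariant mass of a set of vertices. -/
def piSet (A : Set I) : ℝ≥0∞ := ∑' y : A, c.invm (y : I)

/-- `E[T^x_y]`, the expected hitting time of `y` for the chain started at `x`. -/
def ET (x y : I) : ℝ≥0∞ := ∫⁻ ω, hitTime y ω ∂(c.law x)

/-- `E[(T^x_y)²]`, the second moment of the hitting time of `y` started at `x`. -/
def ET2 (x y : I) : ℝ≥0∞ := ∫⁻ ω, (hitTime y ω) ^ 2 ∂(c.law x)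

/-- The normalised hitting time `T^x_y / E[T^x_y]` as a real random variable. -/
def ratio (x y : I) (ω : ℕ → I) : ℝ := (hitTime y ω).toReal / (c.ET x y).toReal

/-- `α(a)`: the child of the root lying on the path from `a` to the root. -/
def alphaVert (a : I) : I := c.par^[c.depth a - 1] a

/-- The drift constant `K_a = sup_{b ∈ B_{α(a)}} μ_b · E[T^b_{p(b)}]`. -/
def Kdrift (a : I) : ℝ≥0∞ :=
  ⨆ b ∈ c.branch (c.alphaVert a), c.mu b * c.ET b (c.par b)

/-- The global constant `K'_a = sup_{b ∈ I} μ_b · E[T^b_{p(b)}]`. -/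
def Kdrift' : ℝ≥0∞ := ⨆ b : I, c.mu b * c.ET b (c.par b)

/-- The quantity `Q_x = π(B_x)⁻¹ · Σ_{b ∈ B_x} π(B_b)²/(μ_b π(b))`. -/
def Qx (x : I) : ℝ≥0∞ :=
  (c.piSet (c.branch x))⁻¹ *
    ∑' b : c.branch x, (c.piSet (c.branch (b : I))) ^ 2 / (c.mu (b : I) * c.invm (b : I))

/-- `Q_a = sup_{x ∈ ℓ(a)} Q_x`. -/
def Qsup (a : I) : ℝ≥0∞ := ⨆ x ∈ c.pathToRoot a, c.Qx x

/-- `R_a = Σ_{b ∈ ℓ(a)} π(B_b)²/(μ_b π(b))`. -/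
def Rsum (a : I) : ℝ≥0∞ :=
  ∑' b : c.pathToRoot a, (c.piSet (c.branch (b : I))) ^ 2 / (c.mu (b : I) * c.invm (b : I))

/-- The set `C_{a,k}`: union over the vertices `a_l`, `k < l ≤ d(a)`, of the path from
`a_k` to the root, of the branches stemming from the children of `a_l` other
than `a_{l-1}`. -/
def Cset (a : I) (k : ℕ) : Set I :=
  {y | ∃ l, k + 1 ≤ l ∧ l ≤ c.depth a ∧
    ∃ ch, ch ∈ c.children (c.par^[l] a) ∧ ch ≠ c.par^[l - 1] a ∧ y ∈ c.branch ch}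

end TreeChain

/-- The strong drift condition `0^ℓ-SD` toward the root, for a family of chains
`c n` with distinguished vertices `a n` (the limit `a → ∞` being `n → ∞`). -/
def StrongDrift {I : ℕ → Type*} [∀ n, MeasurableSpace (I n)]
    (c : ∀ n, TreeChain (I n)) (a : ∀ n, I n) : Prop :=
  (∃ Kmu : ℝ≥0∞, 0 < Kmu ∧
      ∀ n, ∀ b ∈ (c n).branch ((c n).alphaVert (a n)), Kmu ≤ (c n).mu b) ∧
  Tendsto (fun n => ((c n).Kdrift (a n)) ^ 2 / (c n).ET (a n) (c n).root) atTop (𝓝 0)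

namespace TreeChain

variable {I : Type*} [MeasurableSpace I] (c : TreeChain I)

/-! ### Measurability of the singletons -/

/-- If no measurable set separates `f a` from `a`, then no measurable set of sequences separates
`f ∘ ω` from `ω`. -/
theorem comp_mem_iff_of_measurableSet {f : I → I}
    (hf : ∀ S : Set I, MeasurableSet S → f ⁻¹' S = S) {S : Set (ℕ → I)} (hS : MeasurableSet S)
    (ω : ℕ → I) : f ∘ ω ∈ S ↔ ω ∈ S := by
  have hle : (MeasurableSpace.pi : MeasurableSpace (ℕ → I)) ≤
      MeasurableSpace.invariants (fun ω : ℕ → I => f ∘ ω) := by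
    refine iSup_le fun i => ?_
    rintro _ ⟨T, hT, rfl⟩
    refine MeasurableSpace.measurableSet_invariants.2 ⟨measurable_pi_apply i hT, ?_⟩
    ext ω
    exact Set.ext_iff.1 (hf T hT) (ω i)
  exact Set.ext_iff.1 (MeasurableSpace.measurableSet_invariants.1 (hle S hS)).2 ω

theorem law_cyl_one (x y : I) : c.law x {ω | ω 0 = x ∧ ω 1 = y} = c.P x y := by
  have h := c.law_cyl x 1 (fun i => if i = 0 then x else y) rfl
  simp only [Finset.range_one, Finset.prod_singleton] at h
  simpa [Nat.le_one_iff_eq_zero_or_eq_one] using h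

theorem exists_separating [Countable I] {y z : I} (hy : y ≠ c.root) (hyz : y ≠ z) :
    ∃ S, MeasurableSet S ∧ ¬ (y ∈ S ↔ z ∈ S) := by
  classical
  by_contra! hsep
  set x := c.par y
  let f : I → I := fun a => if a = y then z else a
  have hf : ∀ S : Set I, MeasurableSet S → f ⁻¹' S = S := by
    intro S hS
    ext a
    by_cases ha : a = y
    · subst ha
      simpa [f] using (hsep S hS).symm
    · simp [f, ha]
  set C : I → Set (ℕ → I) := fun a => {ω | ω 0 = x ∧ ω 1 = a} with hC
  -- any measurable set containing the cylinders over `a ≠ y` contains the one over `y`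
  have hsub : {ω : ℕ → I | ω 0 = x} ⊆
      toMeasurable (c.law x) (⋃ a : {a : I // a ≠ y}, C a) := by
    intro ω hω
    have hx : x ≠ y := by
      intro h
      have := c.depth_par y hy
      rw [show c.par y = y from h] at this
      omega
    rw [← comp_mem_iff_of_measurableSet hf (measurableSet_toMeasurable _ _)]
    apply subset_toMeasurable
    have hω : ω 0 = x := hω
    refine Set.mem_iUnion.2 ⟨⟨f (ω 1), ?_⟩, ?_, rfl⟩
    · by_cases h : ω 1 = y
      · simpa [f, h] using hyz.symm
      · simp [f, h]
    · simp [f, hω, hx]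
  have h1 : (1 : ℝ≥0∞) ≤ ∑' a : {a : I // a ≠ y}, c.P x a :=
    calc (1 : ℝ≥0∞) = c.law x {ω | ω 0 = x} := (c.law_start x).symm
      _ ≤ c.law x (toMeasurable (c.law x) (⋃ a : {a : I // a ≠ y}, C a)) := measure_mono hsub
      _ = c.law x (⋃ a : {a : I // a ≠ y}, C a) := measure_toMeasurable _
      _ ≤ ∑' a : {a : I // a ≠ y}, c.law x (C a) := measure_iUnion_le _
      _ = ∑' a : {a : I // a ≠ y}, c.P x a := by simp only [hC, law_cyl_one]
  have h2 : c.P x y + ∑' a : {a : I // a ≠ y}, c.P x a = 1 := by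
    rw [← c.P_row x, ← ENNReal.summable.tsum_add_tsum_compl (s := {y}) ENNReal.summable,
      tsum_singleton]
    rfl
  have h3 : c.P x y + 1 ≤ 0 + 1 := by
    rw [zero_add]
    exact (add_le_add_right h1 _).trans h2.le
  exact c.lam_pos y hy (nonpos_iff_eq_zero.1 ((ENNReal.add_le_add_iff_right ENNReal.one_ne_top).1 h3))

/-- The cylinder formula forces the σ-algebra on the vertices to contain all singletons. -/
theorem measurableSingletonClass (c : TreeChain I) [Countable I] : MeasurableSingletonClass I := by
  refine ⟨fun a => ?_⟩
  have h : ∀ b : {b : I // b ≠ a}, ∃ S, MeasurableSet S ∧ a ∈ S ∧ (b : I) ∉ S := by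
    rintro ⟨b, hb⟩
    obtain ⟨S, hS, h⟩ : ∃ S, MeasurableSet S ∧ ¬ (a ∈ S ↔ b ∈ S) := by
      by_cases ha : a = c.root
      · obtain ⟨S, hS, h⟩ := c.exists_separating (ha ▸ hb) hb
        exact ⟨S, hS, fun h' => h h'.symm⟩
      · exact c.exists_separating ha hb.symm
    by_cases haS : a ∈ S
    · exact ⟨S, hS, haS, fun hbS => h (iff_of_true haS hbS)⟩
    · exact ⟨Sᶜ, hS.compl, haS, fun hbS => h (iff_of_false haS hbS)⟩
  choose S hS haS hbS using h
  have : ({a} : Set I) = ⋂ b, S b := by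
    ext z
    simp only [Set.mem_singleton_iff, Set.mem_iInter]
    refine ⟨fun hz b => hz ▸ haS b, fun hz => ?_⟩
    by_contra hne
    exact hbS ⟨z, hne⟩ (hz ⟨z, hne⟩)
  rw [this]
  exact MeasurableSet.iInter hS

/-! ### Survival probabilities -/

open Classical in
/-- The probability that the chain started at `y` avoids `p` at all times `0, …, n`. -/
def surv (p : I) : ℕ → I → ℝ≥0∞
  | 0, y => if y = p then 0 else 1
  | n + 1, y => if y = p then 0 else ∑' z, c.P y z * surv p n z

theorem surv_self (p : I) (n : ℕ) : c.surv p n p = 0 := by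
  cases n <;> simp [surv]

theorem surv_succ {p y : I} (hy : y ≠ p) (n : ℕ) :
    c.surv p (n + 1) y = ∑' z, c.P y z * c.surv p n z := by
  simp [surv, hy]

theorem surv_le_one (p : I) (n : ℕ) (y : I) : c.surv p n y ≤ 1 := by
  induction n generalizing y with
  | zero => unfold surv; split_ifs <;> simp
  | succ n ih =>
    by_cases hy : y = p
    · simp [hy, surv_self]
    · rw [c.surv_succ hy, ← c.P_row y]
      exact ENNReal.tsum_le_tsum fun z => mul_le_of_le_one_right' (ih z)

theorem law_cyl_avoid [Countable I] (x p : I) (n m : ℕ) (γ : ℕ → I) (hγ : γ 0 = x) :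
    c.law x {ω | (∀ i ≤ m, ω i = γ i) ∧ ∀ i, m ≤ i → i ≤ m + n → ω i ≠ p} =
      (∏ i ∈ Finset.range m, c.P (γ i) (γ (i + 1))) * c.surv p n (γ m) := by
  classical
  have := c.measurableSingletonClass
  induction n generalizing m γ with
  | zero =>
    by_cases hp : γ m = p
    · rw [hp, surv_self, mul_zero]
      convert measure_empty (μ := c.law x)
      ext ω
      simp only [Set.mem_ofPred_eq, Set.mem_empty_iff_false, iff_false, not_and]
      exact fun h h' => h' m le_rfl le_rfl ((h m le_rfl).trans hp)
    · simp only [surv, hp, if_false, mul_one, ← c.law_cyl x m γ hγ]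
      congr 1
      ext ω
      simp only [Set.mem_ofPred_eq, and_iff_left_iff_imp]
      intro h i h1 h2
      obtain rfl : i = m := by omega
      rwa [h i le_rfl]
  | succ n ih =>
    by_cases hp : γ m = p
    · rw [hp, surv_self, mul_zero]
      convert measure_empty (μ := c.law x)
      ext ω
      simp only [Set.mem_ofPred_eq, Set.mem_empty_iff_false, iff_false, not_and]
      exact fun h h' => h' m le_rfl (by omega) ((h m le_rfl).trans hp)
    · let γ' : I → ℕ → I := fun z => Function.update γ (m + 1) z
      have hne : ∀ z, ∀ i ≤ m, γ' z i = γ i := fun z i hi =>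
        Function.update_of_ne (by omega) _ _
      have heq : ∀ z, γ' z (m + 1) = z := fun z => Function.update_self _ _ _
      have hunion : {ω : ℕ → I | (∀ i ≤ m, ω i = γ i) ∧
          ∀ i, m ≤ i → i ≤ m + (n + 1) → ω i ≠ p} =
          ⋃ z, {ω | (∀ i ≤ m + 1, ω i = γ' z i) ∧
            ∀ i, m + 1 ≤ i → i ≤ m + 1 + n → ω i ≠ p} := by
        ext ω
        simp only [Set.mem_ofPred_eq, Set.mem_iUnion]
        constructor
        · rintro ⟨h1, h2⟩
          refine ⟨ω (m + 1), fun i hi => ?_, fun i hi hi' => h2 i (by omega) (by omega)⟩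
          rcases Nat.le_succ_iff.1 hi with hi | rfl
          · rw [h1 i hi, hne _ i hi]
          · rw [heq]
        · rintro ⟨z, h1, h2⟩
          have h3 : ∀ i ≤ m, ω i = γ i := fun i hi => by rw [h1 i (by omega), hne z i hi]
          refine ⟨h3, fun i hi hi' => ?_⟩
          rcases hi.eq_or_lt with rfl | hi
          · rwa [h3 m le_rfl]
          · exact h2 i hi (by omega)
      rw [hunion, measure_iUnion]
      · rw [c.surv_succ hp, ← ENNReal.tsum_mul_left]
        refine tsum_congr fun z => ?_
        rw [ih (m + 1) (γ' z) ((hne z 0 (Nat.zero_le _)).trans hγ), Finset.prod_range_succ, heq,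
          hne z m le_rfl, mul_assoc]
        congr 1
        refine Finset.prod_congr rfl fun i hi => ?_
        have := Finset.mem_range.1 hi
        rw [hne z i (by omega), hne z (i + 1) (by omega)]
      · intro z z' hzz'
        refine Set.disjoint_left.2 fun ω h h' => hzz' ?_
        rw [← heq z, ← heq z', ← h.1 _ le_rfl, ← h'.1 _ le_rfl]
      · intro z
        measurability

theorem law_avoid [Countable I] (x p : I) (n : ℕ) :
    c.law x {ω | ∀ i ≤ n, ω i ≠ p} = c.surv p n x := by
  have := c.measurableSingletonClass
  have := c.law_prob x
  have h := c.law_cyl_avoid x p n 0 (fun _ => x) rfl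
  simp only [Finset.range_zero, Finset.prod_empty, one_mul] at h
  rw [← h]
  have hae : ∀ᵐ ω ∂c.law x, ω 0 = x := by
    have hm : MeasurableSet {ω : ℕ → I | ω 0 = x} := by measurability
    exact (prob_compl_eq_zero_iff hm).2 (c.law_start x)
  refine measure_congr (eventuallyEq_set.2 ?_)
  filter_upwards [hae] with ω hω
  simp [hω]

theorem hitTime_eq_tsum {I : Type*} (p : I) (ω : ℕ → I) :
    hitTime p ω = ∑' n : ℕ, {ω : ℕ → I | ∀ i ≤ n, ω i ≠ p}.indicator 1 ω := by
  classical
  by_cases h : ∃ t, ω t = p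
  · have hfind : hitTime p ω = (Nat.find h : ℝ≥0∞) := by
      refine le_antisymm (iInf₂_le (Nat.find h) (Nat.find_spec h)) (le_iInf₂ fun t ht => ?_)
      exact_mod_cast Nat.find_min' h ht
    rw [hfind, tsum_eq_sum (s := Finset.range (Nat.find h))]
    · rw [Finset.sum_congr rfl (g := fun _ => (1 : ℝ≥0∞))]
      · simp
      · intro n hn
        refine Set.indicator_of_mem (s := {ω : ℕ → I | ∀ i ≤ n, ω i ≠ p}) ?_ 1
        exact fun i hi => Nat.find_min h (hi.trans_lt (Finset.mem_range.1 hn))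
    · intro n hn
      refine Set.indicator_of_notMem (s := {ω : ℕ → I | ∀ i ≤ n, ω i ≠ p}) ?_ 1
      exact fun hmem => hmem _ (by simpa using hn) (Nat.find_spec h)
  · push Not at h
    have h1 : hitTime p ω = ⊤ := by simp [hitTime, h]
    have h2 : ∀ n : ℕ, {ω : ℕ → I | ∀ i ≤ n, ω i ≠ p}.indicator (1 : (ℕ → I) → ℝ≥0∞) ω = 1 :=
      fun n => Set.indicator_of_mem (s := {ω : ℕ → I | ∀ i ≤ n, ω i ≠ p}) (fun i _ => h i) 1
    simp [h1, h2]

theorem ET_eq_tsum_surv [Countable I] (x p : I) : c.ET x p = ∑' n, c.surv p n x := by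
  have := c.measurableSingletonClass
  have hm : ∀ n : ℕ, MeasurableSet {ω : ℕ → I | ∀ i ≤ n, ω i ≠ p} := fun n => by measurability
  simp only [ET, hitTime_eq_tsum]
  rw [lintegral_tsum fun n => (measurable_one.indicator (hm n)).aemeasurable]
  exact tsum_congr fun n => by rw [lintegral_indicator_one (hm n), law_avoid]

/-! ### Branches -/

theorem self_mem_branch (x : I) : x ∈ c.branch x := ⟨0, rfl⟩

theorem mem_branch_of_par_mem {x y : I} (h : c.par y ∈ c.branch x) : y ∈ c.branch x :=
  let ⟨n, hn⟩ := h
  ⟨n + 1, hn⟩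

theorem par_mem_branch {x y : I} (h : y ∈ c.branch x) (hyx : y ≠ x) : c.par y ∈ c.branch x := by
  obtain ⟨n, hn⟩ := h
  cases n with
  | zero => exact absurd hn hyx
  | succ n => exact ⟨n, hn⟩

theorem depth_par_le (y : I) : c.depth (c.par y) ≤ c.depth y := by
  by_cases hy : y = c.root
  · rw [hy, c.par_root]
  · rw [c.depth_par y hy]
    exact Nat.le_succ _

theorem depth_le_of_mem_branch {x y : I} (h : y ∈ c.branch x) : c.depth x ≤ c.depth y := by
  obtain ⟨n, rfl⟩ := h
  induction n generalizing y with
  | zero => rfl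
  | succ n ih => exact ih.trans (c.depth_par_le y)

theorem par_notMem_branch {x : I} (hx : x ≠ c.root) : c.par x ∉ c.branch x := fun h => by
  have h1 := c.depth_le_of_mem_branch h
  have h2 := c.depth_par x hx
  omega

theorem ne_par_of_mem_branch {x y : I} (hx : x ≠ c.root) (hy : y ∈ c.branch x) : y ≠ c.par x :=
  fun h => c.par_notMem_branch hx (h ▸ hy)

theorem ne_root_of_mem_branch {x y : I} (hx : x ≠ c.root) (hy : y ∈ c.branch x) : y ≠ c.root := by
  rintro rfl
  have := c.depth_le_of_mem_branch hy
  rw [c.depth_root] at this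
  exact hx (c.depth_eq_zero x (by omega))

/-- The chain can leave the branch `B_x` only from `x`, to the parent of `x`. -/
theorem mem_branch_of_P_ne_zero {x y z : I} (hy : y ∈ c.branch x) (h : c.P y z ≠ 0) :
    z ∈ c.branch x ∨ (y = x ∧ z = c.par x) := by
  rcases c.P_support y z h with rfl | rfl | rfl
  · exact Or.inl hy
  · by_cases hyx : y = x
    · exact Or.inr ⟨hyx, hyx ▸ rfl⟩
    · exact Or.inl (c.par_mem_branch hy hyx)
  · exact Or.inl (c.mem_branch_of_par_mem hy)

theorem P_le_one (x y : I) : c.P x y ≤ 1 := c.P_row x ▸ ENNReal.le_tsum y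

theorem invm_ne_top (x : I) : c.invm x ≠ ∞ :=
  ne_top_of_le_ne_top ENNReal.one_ne_top (c.invm_sum ▸ ENNReal.le_tsum x)

theorem surv_succ_of_mem_branch {x y : I} (hx : x ≠ c.root) (hy : y ∈ c.branch x) (n : ℕ) :
    c.surv (c.par x) (n + 1) y = ∑' z : c.branch x, c.P y z * c.surv (c.par x) n z := by
  rw [c.surv_succ (c.ne_par_of_mem_branch hx hy)]
  refine (tsum_subtype_eq_of_support_subset fun z hz => ?_).symm
  have hz : c.P y z * c.surv (c.par x) n z ≠ 0 := hz
  rcases c.mem_branch_of_P_ne_zero hy (left_ne_zero_of_mul hz) with h | ⟨-, rfl⟩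
  · exact h
  · exact absurd (c.surv_self _ n) (right_ne_zero_of_mul hz)

open Classical in
theorem tsum_branch_P {x z : I} (hx : x ≠ c.root) (hz : z ∈ c.branch x) :
    (∑' y : c.branch x, c.P z y) + (if z = x then c.mu x else 0) = 1 := by
  rw [← c.P_row z, ← ENNReal.summable.tsum_add_tsum_compl (s := c.branch x) ENNReal.summable]
  congr 1
  rw [tsum_eq_single (⟨c.par x, c.par_notMem_branch hx⟩ : ↥(c.branch x)ᶜ)]
  · split_ifs with h
    · rw [h, mu]
    · by_contra hne
      rcases c.mem_branch_of_P_ne_zero hz (Ne.symm hne) with h' | h'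
      · exact c.par_notMem_branch hx h'
      · exact h h'.1
  · rintro ⟨y, hy⟩ hne
    by_contra h
    rcases c.mem_branch_of_P_ne_zero hz h with h' | h'
    · exact hy h'
    · exact hne (Subtype.ext h'.2)

theorem tsum_invm_mul_surv_succ {x : I} (hx : x ≠ c.root) (n : ℕ) :
    (∑' y : c.branch x, c.invm y * c.surv (c.par x) (n + 1) y) +
      c.mu x * c.invm x * c.surv (c.par x) n x =
    ∑' y : c.branch x, c.invm y * c.surv (c.par x) n y := by
  classical
  have h1 : ∑' y : c.branch x, c.invm y * c.surv (c.par x) (n + 1) y =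
      ∑' z : c.branch x, c.invm z * c.surv (c.par x) n z * ∑' y : c.branch x, c.P z y := by
    simp only [← ENNReal.tsum_mul_left]
    rw [ENNReal.tsum_comm]
    refine tsum_congr fun y => ?_
    rw [c.surv_succ_of_mem_branch hx y.2, ← ENNReal.tsum_mul_left]
    refine tsum_congr fun z => ?_
    rw [← mul_assoc, c.invm_rev, mul_right_comm]
  have h2 : c.mu x * c.invm x * c.surv (c.par x) n x =
      ∑' z : c.branch x, c.invm z * c.surv (c.par x) n z *
        (if (z : I) = x then c.mu x else 0) := by
    rw [tsum_eq_single (⟨x, c.self_mem_branch x⟩ : c.branch x)]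
    · simp only [if_true]
      ring
    · intro z hz
      rw [if_neg fun h => hz (Subtype.ext h), mul_zero]
  rw [h1, h2, ← ENNReal.tsum_add]
  refine tsum_congr fun z => ?_
  rw [← mul_add, c.tsum_branch_P hx z.2, mul_one]

theorem tsum_invm_mul_surv_add_sum {x : I} (hx : x ≠ c.root) (N : ℕ) :
    (∑' y : c.branch x, c.invm y * c.surv (c.par x) N y) +
      c.mu x * c.invm x * ∑ n ∈ Finset.range N, c.surv (c.par x) n x =
    c.piSet (c.branch x) := by
  induction N with
  | zero =>
    simp only [Finset.range_zero, Finset.sum_empty, mul_zero, add_zero, piSet]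
    exact tsum_congr fun y => by simp [surv, c.ne_par_of_mem_branch hx y.2]
  | succ N ih =>
    rw [Finset.sum_range_succ, mul_add, ← ih, ← c.tsum_invm_mul_surv_succ hx N]
    ring

theorem piSet_ne_top (A : Set I) : c.piSet A ≠ ∞ := by
  refine ne_top_of_le_ne_top ENNReal.one_ne_top ?_
  rw [← c.invm_sum]
  exact ENNReal.tsum_comp_le_tsum_of_injective Subtype.val_injective c.invm

theorem mu_mul_invm_ne_zero {x : I} (hx : x ≠ c.root) : c.mu x * c.invm x ≠ 0 :=
  mul_ne_zero (c.mu_pos x hx) (c.invm_pos x)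

theorem mu_mul_invm_ne_top (x : I) : c.mu x * c.invm x ≠ ∞ :=
  ENNReal.mul_ne_top (ne_top_of_le_ne_top ENNReal.one_ne_top (c.P_le_one _ _)) (c.invm_ne_top x)

theorem tsum_surv_ne_top {x : I} (hx : x ≠ c.root) : ∑' n, c.surv (c.par x) n x ≠ ∞ := by
  have h : c.mu x * c.invm x * ∑' n, c.surv (c.par x) n x ≤ c.piSet (c.branch x) := by
    rw [ENNReal.tsum_eq_iSup_nat, ENNReal.mul_iSup]
    exact iSup_le fun N => c.tsum_invm_mul_surv_add_sum hx N ▸ le_add_self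
  intro htop
  rw [htop, ENNReal.mul_top (c.mu_mul_invm_ne_zero hx)] at h
  exact c.piSet_ne_top _ (top_le_iff.1 h)

theorem tendsto_surv {x y : I} (hx : x ≠ c.root) (hy : y ∈ c.branch x) :
    Tendsto (fun n => c.surv (c.par x) n y) atTop (𝓝 0) := by
  obtain ⟨m, hm⟩ := hy
  induction m generalizing y with
  | zero =>
    obtain rfl : y = x := hm
    exact ENNReal.tendsto_atTop_zero_of_tsum_ne_top (c.tsum_surv_ne_top hx)
  | succ m ih =>
    have hp : c.par y ∈ c.branch x := ⟨m, hm⟩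
    have hlam := c.lam_pos y (c.ne_root_of_mem_branch hx (c.mem_branch_of_par_mem hp))
    have hlam_top : c.P (c.par y) y ≠ ∞ := ne_top_of_le_ne_top ENNReal.one_ne_top (c.P_le_one _ _)
    have hlim : Tendsto (fun n => (c.P (c.par y) y)⁻¹ * c.surv (c.par x) (n + 1) (c.par y))
        atTop (𝓝 0) := by
      simpa using ENNReal.Tendsto.const_mul ((tendsto_add_atTop_iff_nat 1).2 (ih hm))
        (Or.inr (ENNReal.inv_ne_top.2 hlam))
    refine tendsto_of_tendsto_of_tendsto_of_le_of_le tendsto_const_nhds hlim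
      (fun _ => zero_le) fun n => ?_
    have hle : c.P (c.par y) y * c.surv (c.par x) n y ≤ c.surv (c.par x) (n + 1) (c.par y) := by
      rw [c.surv_succ (c.ne_par_of_mem_branch hx hp)]
      exact ENNReal.le_tsum y
    calc c.surv (c.par x) n y
        = (c.P (c.par y) y)⁻¹ * (c.P (c.par y) y * c.surv (c.par x) n y) := by
          rw [← mul_assoc, ENNReal.inv_mul_cancel hlam hlam_top, one_mul]
      _ ≤ _ := by gcongr

theorem tendsto_tsum_invm_mul_surv {x : I} (hx : x ≠ c.root) :
    Tendsto (fun n => ∑' y : c.branch x, c.invm y * c.surv (c.par x) n y) atTop (𝓝 0) := by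
  let _ : MeasurableSpace (c.branch x) := ⊤
  have h := tendsto_lintegral_of_dominated_convergence (μ := Measure.count)
    (F := fun n (y : c.branch x) => c.invm y * c.surv (c.par x) n y) (f := fun _ => 0)
    (fun y => c.invm y) (fun n => measurable_from_top)
    (fun n => Eventually.of_forall fun y => mul_le_of_le_one_right' (c.surv_le_one _ _ _))
    (by rw [lintegral_count]; exact c.piSet_ne_top _)
    (Eventually.of_forall fun y => by
      simpa using ENNReal.Tendsto.const_mul (c.tendsto_surv hx y.2) (Or.inr (c.invm_ne_top y)))
  simpa only [lintegral_count, tsum_zero] using h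

end TreeChain

/-- **Lemma (3.1), first moment child → parent**:
`E[T^x_{p(x)}] = π(B_x)/(μ_x·π(x))`. -/
theorem ET_child_parent {I : Type*} [MeasurableSpace I] [Countable I]
    (c : TreeChain I) (x : I) (hx : x ≠ c.root) :
    c.ET x (c.par x) = c.piSet (c.branch x) / (c.mu x * c.invm x) := by
  rw [c.ET_eq_tsum_surv, ENNReal.eq_div_iff (c.mu_mul_invm_ne_zero hx) (c.mu_mul_invm_ne_top x)]
  have h := (c.tendsto_tsum_invm_mul_surv hx).add (ENNReal.Tendsto.const_mul
    (ENNReal.tendsto_nat_tsum fun n => c.surv (c.par x) n x) (Or.inr (c.mu_mul_invm_ne_top x)))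
  simp only [c.tsum_invm_mul_surv_add_sum hx, zero_add] at h
  exact tendsto_nhds_unique tendsto_const_nhds h |>.symm
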